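/- arXiv:1609.04362 — 3 statements merged into one kernel-verified Lean document; each statement's English description precedes it below -/
import Mathlib

section
/- For i = 1,2 let (L_i,Δ_i,S_i) be a locality. Then the triple (L_1 × L_2, Δ_1*Δ_2, S_1 × S_2), where L_1 × L_2 is the external direct product of the partial groups L_1 and L_2 and Δ_1*Δ_2 is the set of subgroups of S_1 × S_2 containing a subgroup of the form P_1 × P_2 with P_i ∈ Δ_i for i = 1,2, is a locality. -/
/-!
Background definitions for partial groups and localities in the sense of Chermak.

A *partial group* is given by `Data`: a domain `D` of words, a (total, but only
meaningful on `D`) product `pi : List L → L`, and an inversion map, subject to the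
axioms collected in `IsPartialGroup`.
-/

namespace PartialGroups

/-- The underlying data of a partial group. -/
structure Data (L : Type*) where
  /-- The domain of the product, a set of words. -/
  D : Set (List L)
  /-- The product `Π`, meaningful on `D`. -/
  pi : List L → L
  /-- The inversion map. -/
  inv : L → L

variable {L L' L₁ L₂ L₁' L₂' : Type*}

/-- The formal inverse of a word: `(f₁,…,fₙ)⁻¹ = (fₙ⁻¹,…,f₁⁻¹)`. -/
def Data.wInv (P : Data L) (w : List L) : List L := (w.map P.inv).reverse

/-- The identity element `1 = Π(∅)`. -/
def Data.one (P : Data L) : L := P.pi []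

/-- The axioms of a partial group. -/
structure IsPartialGroup (P : Data L) : Prop where
  /-- Inversion is an involution (in particular a bijection). -/
  inv_inv : ∀ f : L, P.inv (P.inv f) = f
  /-- `L ⊆ D` (words of length one lie in the domain). -/
  singleton_mem : ∀ f : L, [f] ∈ P.D
  /-- `u ∘ v ∈ D` implies `u ∈ D`. -/
  append_left : ∀ u v : List L, u ++ v ∈ P.D → u ∈ P.D
  /-- `u ∘ v ∈ D` implies `v ∈ D`. -/
  append_right : ∀ u v : List L, u ++ v ∈ P.D → v ∈ P.D
  /-- `Π` restricts to the identity on words of length one. -/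
  pi_singleton : ∀ f : L, P.pi [f] = f
  /-- `u ∘ v ∘ w ∈ D` implies `u ∘ (Π(v)) ∘ w ∈ D`. -/
  assoc_mem : ∀ u v w : List L, u ++ v ++ w ∈ P.D → u ++ [P.pi v] ++ w ∈ P.D
  /-- `Π(u ∘ v ∘ w) = Π(u ∘ (Π(v)) ∘ w)`. -/
  assoc_pi : ∀ u v w : List L, u ++ v ++ w ∈ P.D →
    P.pi (u ++ v ++ w) = P.pi (u ++ [P.pi v] ++ w)
  /-- `w ∈ D` implies `w⁻¹ ∘ w ∈ D`. -/
  wInv_mem : ∀ w ∈ P.D, P.wInv w ++ w ∈ P.D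
  /-- `Π(w⁻¹ ∘ w) = 1`. -/
  wInv_pi : ∀ w ∈ P.D, P.pi (P.wInv w ++ w) = P.one

/-- `D(g)`: the set of `x` for which `x^g` is defined. -/
def Data.Dconj (P : Data L) (g : L) : Set L := {x | [P.inv g, x, g] ∈ P.D}

/-- Conjugation `x^g = Π(g⁻¹, x, g)`. -/
def Data.conj (P : Data L) (x g : L) : L := P.pi [P.inv g, x, g]

/-- `X^g = {x^g : x ∈ X}`. -/
def Data.conjSet (P : Data L) (X : Set L) (g : L) : Set L := (fun x => P.conj x g) '' X

/-- `W(H)`: the set of words with all entries in `H`. -/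
def Wrd (H : Set L) : Set (List L) := {w | ∀ x ∈ w, x ∈ H}

/-- The centralizer `C_L(X) = {g : x ∈ D(g) and x^g = x for all x ∈ X}`. -/
def Data.centralizer (P : Data L) (X : Set L) : Set L :=
  {g | ∀ x ∈ X, x ∈ P.Dconj g ∧ P.conj x g = x}

/-- The center `Z(L) = C_L(L)`. -/
def Data.center (P : Data L) : Set L := P.centralizer Set.univ

/-- The normalizer `N_L(X) = {g : X ⊆ D(g) and X^g = X}`. -/
def Data.normalizer (P : Data L) (X : Set L) : Set L :=
  {g | X ⊆ P.Dconj g ∧ P.conjSet X g = X}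

/-- The centralizer of `X` computed inside the partial subgroup `L₀`. -/
def Data.centralizerIn (P : Data L) (L₀ X : Set L) : Set L := L₀ ∩ P.centralizer X

/-- The center of the partial subgroup `L₀` (with its restricted partial product). -/
def Data.centerIn (P : Data L) (L₀ : Set L) : Set L := P.centralizerIn L₀ L₀

/-- The set product `XY = {Π(x,y) : x ∈ X, y ∈ Y, (x,y) ∈ D}`. -/
def Data.setMul (P : Data L) (X Y : Set L) : Set L :=
  {z | ∃ x ∈ X, ∃ y ∈ Y, [x, y] ∈ P.D ∧ P.pi [x, y] = z}

/-- `S_g = {s ∈ S ∩ D(g) : s^g ∈ S}`. -/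
def Data.SOf (P : Data L) (S : Set L) (g : L) : Set L :=
  {s | s ∈ S ∧ s ∈ P.Dconj g ∧ P.conj s g ∈ S}

/-- A partial subgroup: closed under inversion and under products of words in the domain. -/
def Data.IsPartialSubgroup (P : Data L) (H : Set L) : Prop :=
  (∀ f ∈ H, P.inv f ∈ H) ∧ ∀ w ∈ Wrd H ∩ P.D, P.pi w ∈ H

/-- A subgroup: a partial subgroup `H` with `W(H) ⊆ D`. -/
def Data.IsSubgroup (P : Data L) (H : Set L) : Prop :=
  P.IsPartialSubgroup H ∧ Wrd H ⊆ P.D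

/-- A `p`-subgroup: a subgroup whose order is a power of `p`. -/
def Data.IsPSubgroup (p : ℕ) (P : Data L) (H : Set L) : Prop :=
  P.IsSubgroup H ∧ ∃ n : ℕ, H.ncard = p ^ n

/-- A partial normal subgroup: `n^f ∈ N` for all `f ∈ L` and `n ∈ N ∩ D(f)`. -/
def Data.IsPartialNormal (P : Data L) (N : Set L) : Prop :=
  P.IsPartialSubgroup N ∧ ∀ f : L, ∀ n ∈ N, n ∈ P.Dconj f → P.conj n f ∈ N

/-- A homomorphism of partial groups: `Dβ* ⊆ D'` and `Π'(vβ*) = (Π(v))β`. -/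
def IsHom (P : Data L) (P' : Data L') (β : L → L') : Prop :=
  (∀ w ∈ P.D, w.map β ∈ P'.D) ∧ ∀ w ∈ P.D, P'.pi (w.map β) = β (P.pi w)

/-- A projection of partial groups: a homomorphism with `Dβ* = D'`. -/
def IsProjection (P : Data L) (P' : Data L') (β : L → L') : Prop :=
  IsHom P P' β ∧ ∀ w' ∈ P'.D, ∃ w ∈ P.D, w.map β = w'

/-- An isomorphism of partial groups: an injective projection. -/
def IsIsomorphism (P : Data L) (P' : Data L') (β : L → L') : Prop :=
  IsProjection P P' β ∧ Function.Injective β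

/-- The kernel `ker(β) = {f : fβ = 1'}`. -/
def pgKer (P : Data L) (P' : Data L') (β : L → L') : Set L := {f | β f = P'.one}

/-- `β` restricted to the partial subgroup `L₀` is a homomorphism of partial groups
(the source being `L₀` with the restricted product). -/
def IsHomBetween (P : Data L) (P' : Data L') (L₀ : Set L) (β : L → L') : Prop :=
  (∀ w ∈ P.D ∩ Wrd L₀, w.map β ∈ P'.D) ∧
    ∀ w ∈ P.D ∩ Wrd L₀, P'.pi (w.map β) = β (P.pi w)

/-- `β` restricted to a map `L₀ → L₀'` is a projection of partial groups between
the restricted partial groups on `L₀` and `L₀'` (so `(D ∩ W(L₀))β* = D' ∩ W(L₀')`). -/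
def IsProjBetween (P : Data L) (P' : Data L') (L₀ : Set L) (L₀' : Set L') (β : L → L') :
    Prop :=
  β '' L₀ = L₀' ∧ IsHomBetween P P' L₀ β ∧
    ∀ w' ∈ P'.D ∩ Wrd L₀', ∃ w ∈ P.D ∩ Wrd L₀, w.map β = w'

/-- `β` restricted to a map `L₀ → L₀'` is an isomorphism of partial groups. -/
def IsIsoBetween (P : Data L) (P' : Data L') (L₀ : Set L) (L₀' : Set L') (β : L → L') :
    Prop :=
  IsProjBetween P P' L₀ L₀' β ∧ Set.InjOn β L₀

/-- `chainFrom P Δ w Q` means: the word `w` lies in `D_Δ` via the chain starting at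
`P₀ = Q`, i.e. there are `P₀,…,Pₙ ∈ Δ` with `P_{i-1} ⊆ D(f_i)` and `P_{i-1}^{f_i} = P_i`. -/
def chainFrom (P : Data L) (Δ : Set (Set L)) : List L → Set L → Prop
  | [], _ => True
  | f :: w, Q => Q ⊆ P.Dconj f ∧ P.conjSet Q f ∈ Δ ∧ chainFrom P Δ w (P.conjSet Q f)

/-- The set of words `D_Δ`. -/
def DDelta (P : Data L) (Δ : Set (Set L)) : Set (List L) :=
  {w | ∃ Q ∈ Δ, chainFrom P Δ w Q}

/-- `(L,Δ,S)` is a locality (for the prime `p`). -/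
structure IsLocality (p : ℕ) (P : Data L) (Δ : Set (Set L)) (S : Set L) : Prop where
  isPartialGroup : IsPartialGroup P
  /-- `L` is finite as a set. -/
  finite : Finite L
  /-- `S` is a `p`-subgroup of `L`. -/
  pSubgroup : P.IsPSubgroup p S
  /-- `Δ` is nonempty. -/
  delta_nonempty : Δ.Nonempty
  /-- `Δ` is a set of subgroups of `S`. -/
  delta_subgroups : ∀ Q ∈ Δ, P.IsSubgroup Q ∧ Q ⊆ S
  /-- (L1): `S` is maximal among the `p`-subgroups of `L`. -/
  s_maximal : ∀ T : Set L, P.IsPSubgroup p T → S ⊆ T → T = S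
  /-- (L2): `D = D_Δ`. -/
  d_eq : P.D = DDelta P Δ
  /-- (L3): overgroups in `S` of conjugates of members of `Δ` lie in `Δ`. -/
  delta_closed : ∀ Q : Set L, P.IsSubgroup Q → Q ⊆ S →
    (∃ R ∈ Δ, ∃ g : L, R ⊆ P.Dconj g ∧ P.conjSet R g ⊆ Q) → Q ∈ Δ

/-- `(L₀,Δ,S)` is a locality, where `L₀` is a partial subgroup of the ambient partial
group and `L₀` is regarded as a partial group with the restricted product.  All the
conditions are expressed via the ambient product (with which the restricted one
agrees on words in `W(L₀)`). -/
structure IsLocalityIn (p : ℕ) (P : Data L) (L₀ : Set L) (Δ : Set (Set L)) (S : Set L) :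
    Prop where
  partialSubgroup : P.IsPartialSubgroup L₀
  /-- `L₀` is finite as a set. -/
  finite : L₀.Finite
  /-- `S` is a `p`-subgroup. -/
  pSubgroup : P.IsPSubgroup p S
  s_sub : S ⊆ L₀
  delta_nonempty : Δ.Nonempty
  delta_subgroups : ∀ Q ∈ Δ, P.IsSubgroup Q ∧ Q ⊆ S
  /-- (L1) for the restriction. -/
  s_maximal : ∀ T : Set L, T ⊆ L₀ → P.IsPSubgroup p T → S ⊆ T → T = S
  /-- (L2) for the restriction. -/
  d_eq : ∀ w ∈ Wrd L₀, (w ∈ P.D ↔ w ∈ DDelta P Δ)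
  /-- (L3) for the restriction. -/
  delta_closed : ∀ Q : Set L, P.IsSubgroup Q → Q ⊆ S →
    (∃ R ∈ Δ, ∃ g ∈ L₀, R ⊆ P.Dconj g ∧ P.conjSet R g ⊆ Q) → Q ∈ Δ

/-- `(L₀,Δ₀,S₀)` is a sublocality of a locality with Sylow subgroup `S`. -/
def IsSubLocality (p : ℕ) (P : Data L) (S : Set L) (L₀ : Set L) (Δ₀ : Set (Set L))
    (S₀ : Set L) : Prop :=
  S₀ = S ∩ L₀ ∧ IsLocalityIn p P L₀ Δ₀ S₀

/-- A projection of localities: a projection of partial groups with `Δβ = Δ'`. -/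
def IsLocalityProj (P : Data L) (P' : Data L') (Δ : Set (Set L)) (Δ' : Set (Set L'))
    (β : L → L') : Prop :=
  IsProjection P P' β ∧ Set.image β '' Δ = Δ'

/-- `β` restricted to `L₀ → L₀'` is a projection of localities. -/
def IsLocalityProjBetween (P : Data L) (P' : Data L') (L₀ : Set L) (Δ₀ : Set (Set L))
    (L₀' : Set L') (Δ₀' : Set (Set L')) (β : L → L') : Prop :=
  IsProjBetween P P' L₀ L₀' β ∧ Set.image β '' Δ₀ = Δ₀'

/-- The right coset `Nf = {Π(n,f) : n ∈ N, (n,f) ∈ D}`. -/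
def rightCoset (P : Data L) (N : Set L) (f : L) : Set L :=
  {y | ∃ n ∈ N, [n, f] ∈ P.D ∧ P.pi [n, f] = y}

/-- The data of the external direct product of two partial groups:  the domain consists
of the words whose words of first resp. second coordinates lie in the respective domains,
and the product and the inversion are computed coordinatewise. -/
def prodData (P₁ : Data L₁) (P₂ : Data L₂) : Data (L₁ × L₂) where
  D := {u | u.map Prod.fst ∈ P₁.D ∧ u.map Prod.snd ∈ P₂.D}
  pi := fun u => (P₁.pi (u.map Prod.fst), P₂.pi (u.map Prod.snd))
  inv := fun f => (P₁.inv f.1, P₂.inv f.2)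

/-- `Δ₁ * Δ₂`: the set of subgroups of `S₁ × S₂` containing some `P₁ × P₂` with
`P_i ∈ Δ_i`. -/
def deltaStar (P₁ : Data L₁) (P₂ : Data L₂) (Δ₁ : Set (Set L₁)) (Δ₂ : Set (Set L₂))
    (S₁ : Set L₁) (S₂ : Set L₂) : Set (Set (L₁ × L₂)) :=
  {Q | (prodData P₁ P₂).IsSubgroup Q ∧ Q ⊆ S₁ ×ˢ S₂ ∧
    ∃ R₁ ∈ Δ₁, ∃ R₂ ∈ Δ₂, R₁ ×ˢ R₂ ⊆ Q}

/-- `K` is a normal `p`-subgroup of the subgroup `M` of the ambient partial group. -/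
def Data.IsNormalPSubgroupIn (p : ℕ) (P : Data L) (M K : Set L) : Prop :=
  K ⊆ M ∧ P.IsSubgroup K ∧ (∃ n : ℕ, K.ncard = p ^ n) ∧
    ∀ f ∈ M, ∀ x ∈ K, x ∈ P.Dconj f ∧ P.conj x f ∈ K

/-- `O_p(M)`: the largest normal `p`-subgroup of the subgroup `M` (the union of all
normal `p`-subgroups of `M`). -/
def Data.pCoreIn (p : ℕ) (P : Data L) (M : Set L) : Set L :=
  ⋃₀ {K | P.IsNormalPSubgroupIn p M K}

/-- The subgroup `M` of the ambient partial group is of characteristic `p`: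
`C_M(O_p(M)) ≤ O_p(M)`. -/
def Data.IsCharPSubgroup (p : ℕ) (P : Data L) (M : Set L) : Prop :=
  P.centralizerIn M (P.pCoreIn p M) ⊆ P.pCoreIn p M

/-- A locality is of objective characteristic `p` if `N_L(Q)` is of characteristic `p`
for every `Q ∈ Δ`. -/
def IsObjectiveCharP (p : ℕ) (P : Data L) (Δ : Set (Set L)) : Prop :=
  ∀ Q ∈ Δ, P.IsCharPSubgroup p (P.normalizer Q)

/-- The word `(Π(f₁,g₁),…,Π(fₙ,gₙ))` built from the words `u = (f₁,…,fₙ)` and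
`v = (g₁,…,gₙ)`. -/
def zipProd (P : Data L) (u v : List L) : List L :=
  List.zipWith (fun f g => P.pi [f, g]) u v

/-- `L` is the internal central product of `M₁` and `M₂`: conditions (C1) and (C2). -/
def IsInternalCentralProduct (P : Data L) (M₁ M₂ : Set L) : Prop :=
  (P.D = {w | ∃ u v : List L, u ∈ P.D ∩ Wrd M₁ ∧ v ∈ P.D ∩ Wrd M₂ ∧
      u.length = v.length ∧ (∀ q ∈ u.zip v, [q.1, q.2] ∈ P.D) ∧ w = zipProd P u v}) ∧
  ∀ u v : List L, u ∈ P.D ∩ Wrd M₁ → v ∈ P.D ∩ Wrd M₂ → u.length = v.length →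
    (∀ q ∈ u.zip v, [q.1, q.2] ∈ P.D) →
    P.pi (zipProd P u v) = P.pi [P.pi u, P.pi v]

/-- `L` is the internal direct product of `M₁` and `M₂`: (C1), (C2) and (D). -/
def IsInternalDirectProduct (P : Data L) (M₁ M₂ : Set L) : Prop :=
  IsInternalCentralProduct P M₁ M₂ ∧
    ∀ h : L, ∃! fg : L × L, fg.1 ∈ M₁ ∧ fg.2 ∈ M₂ ∧ [fg.1, fg.2] ∈ P.D ∧
      P.pi [fg.1, fg.2] = h

section PartialGroupBasics

variable {P : Data L} {P' : Data L'}

/-- A subword with product `1` may be deleted from a word in the domain. -/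
theorem IsPartialGroup.erase (hP : IsPartialGroup P) (u v w : List L) (h : u ++ v ++ w ∈ P.D)
    (hv : P.pi v = P.one) : u ++ w ∈ P.D ∧ P.pi (u ++ v ++ w) = P.pi (u ++ w) := by
  have h1 := hP.assoc_mem u v w h
  rw [hv] at h1
  have hmem : u ++ w ∈ P.D := by
    cases w with
    | nil => simpa using hP.append_left u ([P.one] ++ []) (by simpa using h1)
    | cons y w =>
      have h2 := hP.assoc_mem u [P.one, y] w (by simpa using h1)
      have h3 : P.pi [P.one, y] = y := by
        have := hP.assoc_pi [] [] [y] (by simpa using hP.singleton_mem y)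
        simp only [List.nil_append, List.append_nil, List.singleton_append] at this
        rw [hP.pi_singleton] at this
        exact this.symm
      rw [h3] at h2
      simpa using h2
  refine ⟨hmem, ?_⟩
  have h4 := hP.assoc_pi u [] w (by simpa using hmem)
  rw [hP.assoc_pi u v w h, hv]
  simpa [Data.one] using h4.symm

theorem IsPartialGroup.wInv_wInv (hP : IsPartialGroup P) (w : List L) :
    P.wInv (P.wInv w) = w := by
  have : P.inv ∘ P.inv = id := funext hP.inv_inv
  simp [Data.wInv, this]

theorem IsPartialGroup.append_wInv_mem (hP : IsPartialGroup P) {w : List L} (h : w ∈ P.D) :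
    w ++ P.wInv w ∈ P.D := by
  have := hP.wInv_mem (P.wInv w) (hP.append_left _ w (hP.wInv_mem w h))
  rwa [hP.wInv_wInv] at this

theorem IsPartialGroup.pi_append_wInv (hP : IsPartialGroup P) {w : List L} (h : w ∈ P.D) :
    P.pi (w ++ P.wInv w) = P.one := by
  have := hP.wInv_pi (P.wInv w) (hP.append_left _ w (hP.wInv_mem w h))
  rwa [hP.wInv_wInv] at this

theorem IsPartialGroup.pi_inv_self (hP : IsPartialGroup P) (x : L) :
    P.pi [P.inv x, x] = P.one := by
  simpa [Data.wInv] using hP.wInv_pi [x] (hP.singleton_mem x)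

theorem IsPartialGroup.pi_self_inv (hP : IsPartialGroup P) (x : L) :
    P.pi [x, P.inv x] = P.one := by
  simpa [Data.wInv] using hP.pi_append_wInv (hP.singleton_mem x)

theorem IsPartialGroup.eq_inv_of_pi_eq_one (hP : IsPartialGroup P) {a b : L}
    (h : [a, b] ∈ P.D) (h1 : P.pi [a, b] = P.one) : a = P.inv b := by
  have h2 : [a, b, P.inv b] ∈ P.D :=
    hP.append_left _ [P.inv a] (by simpa [Data.wInv] using hP.append_wInv_mem h)
  have h3 := (hP.erase [a] [b, P.inv b] [] (by simpa using h2) (hP.pi_self_inv b)).2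
  have h4 := (hP.erase [] [a, b] [P.inv b] (by simpa using h2) h1).2
  simp only [List.cons_append, List.nil_append, List.append_nil,
    hP.pi_singleton] at h3 h4
  exact h3.symm.trans h4

theorem IsPartialGroup.pi_wInv (hP : IsPartialGroup P) {w : List L} (h : w ∈ P.D) :
    P.pi (P.wInv w) = P.inv (P.pi w) := by
  have h0 := hP.wInv_mem w h
  have h1 := hP.assoc_mem [] (P.wInv w) w (by simpa using h0)
  have h2 := hP.assoc_pi [] (P.wInv w) w (by simpa using h0)
  have h3 := hP.assoc_mem [P.pi (P.wInv w)] w [] (by simpa using h1)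
  have h4 := hP.assoc_pi [P.pi (P.wInv w)] w [] (by simpa using h1)
  refine hP.eq_inv_of_pi_eq_one (by simpa using h3) ?_
  simp only [List.cons_append, List.nil_append, List.append_nil] at h2 h4
  rw [← h4, ← h2, hP.wInv_pi w h]

/-- If `x ∈ D(g)` then `(g, g⁻¹, x, g, g⁻¹)` lies in the domain. -/
theorem IsPartialGroup.conj_word_mem (hP : IsPartialGroup P) {x g : L} (h : x ∈ P.Dconj g) :
    [g, P.inv g, x, g, P.inv g] ∈ P.D := by
  have h1 := hP.wInv_mem _ h
  have h2 : [g, P.inv g, x, g] ∈ P.D :=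
    hP.append_right [P.inv g, P.inv x] _ (by simpa [Data.wInv, hP.inv_inv] using h1)
  have h3 := hP.append_wInv_mem h2
  exact hP.append_left _ [P.inv x, g, P.inv g] (by simpa [Data.wInv, hP.inv_inv] using h3)

theorem IsPartialGroup.conj_mem_Dconj_inv (hP : IsPartialGroup P) {x g : L}
    (h : x ∈ P.Dconj g) : P.conj x g ∈ P.Dconj (P.inv g) := by
  have := hP.assoc_mem [g] [P.inv g, x, g] [P.inv g] (by simpa using hP.conj_word_mem h)
  simpa [Data.Dconj, Data.conj, hP.inv_inv] using this

theorem IsPartialGroup.conj_conj_inv (hP : IsPartialGroup P) {x g : L}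
    (h : x ∈ P.Dconj g) : P.conj (P.conj x g) (P.inv g) = x := by
  have h0 := hP.conj_word_mem h
  have h1 := hP.assoc_pi [g] [P.inv g, x, g] [P.inv g] (by simpa using h0)
  have h2 := hP.erase [] [g, P.inv g] [x, g, P.inv g] (by simpa using h0) (hP.pi_self_inv g)
  have h3 := hP.erase [x] [g, P.inv g] [] (by simpa using h2.1) (hP.pi_self_inv g)
  simp only [List.cons_append, List.nil_append, List.append_nil,
    hP.pi_singleton] at h1 h2 h3
  rw [Data.conj, hP.inv_inv, Data.conj, ← h1, h2.2, h3.2]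

theorem IsPartialGroup.conjSet_inv (hP : IsPartialGroup P) {X : Set L} {g : L}
    (h : X ⊆ P.Dconj g) :
    P.conjSet X g ⊆ P.Dconj (P.inv g) ∧ P.conjSet (P.conjSet X g) (P.inv g) = X := by
  constructor
  · rintro _ ⟨x, hx, rfl⟩
    exact hP.conj_mem_Dconj_inv (h hx)
  · rw [Data.conjSet, Data.conjSet, Set.image_image]
    exact (Set.image_congr fun x hx => hP.conj_conj_inv (h hx)).trans (Set.image_id X)

theorem Data.IsSubgroup.one_mem {H : Set L} (hH : P.IsSubgroup H) :
    P.one ∈ H :=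
  hH.1.2 [] ⟨by simp [Wrd], hH.2 (by simp [Wrd])⟩

theorem Data.IsSubgroup.word_mem {H : Set L} (hH : P.IsSubgroup H) {w : List L}
    (hw : ∀ x ∈ w, x ∈ H) : w ∈ P.D := hH.2 hw

theorem Data.IsSubgroup.pi_mem {H : Set L} (hH : P.IsSubgroup H) {w : List L}
    (hw : ∀ x ∈ w, x ∈ H) : P.pi w ∈ H := hH.1.2 w ⟨hw, hH.2 hw⟩

theorem Data.IsSubgroup.conj_word_mem {H : Set L} (hH : P.IsSubgroup H) {x g : L}
    (hx : x ∈ H) (hg : g ∈ H) : x ∈ P.Dconj g :=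
  hH.word_mem (by simp [hx, hg, hH.1.1 g hg])

theorem Data.IsSubgroup.conj_mem {H : Set L} (hH : P.IsSubgroup H) {x g : L}
    (hx : x ∈ H) (hg : g ∈ H) : P.conj x g ∈ H :=
  hH.pi_mem (by simp [hx, hg, hH.1.1 g hg])

theorem IsPartialGroup.conjSet_self (hP : IsPartialGroup P) {H : Set L} (hH : P.IsSubgroup H)
    {g : L} (hg : g ∈ H) : P.conjSet H g = H := by
  apply Set.Subset.antisymm
  · rintro _ ⟨x, hx, rfl⟩
    exact hH.conj_mem hx hg
  · intro x hx
    have hg' := hH.1.1 g hg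
    refine ⟨P.conj x (P.inv g), hH.conj_mem hx hg', ?_⟩
    have := hP.conj_conj_inv (hH.conj_word_mem hx hg')
    rwa [hP.inv_inv] at this

theorem IsPartialGroup.one_conj (hP : IsPartialGroup P) (g : L) : P.conj P.one g = P.one := by
  have h1 : [P.inv g] ++ [] ++ [g] ∈ P.D := by
    simpa [Data.wInv] using hP.wInv_mem [g] (hP.singleton_mem g)
  have h2 := hP.assoc_pi [P.inv g] [] [g] h1
  simp only [List.singleton_append, List.append_nil, hP.pi_inv_self] at h2
  exact h2.symm

theorem IsPartialGroup.conj_inv (hP : IsPartialGroup P) {x g : L} (h : x ∈ P.Dconj g) :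
    P.conj (P.inv x) g = P.inv (P.conj x g) := by
  have := hP.pi_wInv h
  simpa [Data.wInv, hP.inv_inv, Data.conj] using this

theorem IsPartialGroup.conj_mul (hP : IsPartialGroup P) {x y g : L}
    (h : [P.inv g, x, g, P.inv g, y, g] ∈ P.D) :
    P.pi [P.conj x g, P.conj y g] = P.conj (P.pi [x, y]) g := by
  have h1 := hP.assoc_mem [] [P.inv g, x, g] [P.inv g, y, g] h
  have h1' := hP.assoc_pi [] [P.inv g, x, g] [P.inv g, y, g] h
  have h2 := hP.assoc_pi [P.pi [P.inv g, x, g]] [P.inv g, y, g] [] (by simpa using h1)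
  have h3 := hP.erase [P.inv g, x] [g, P.inv g] [y, g] (by simpa using h) (hP.pi_self_inv g)
  have h4 := hP.assoc_pi [P.inv g] [x, y] [g] (by simpa using h3.1)
  simp only [List.cons_append, List.nil_append, List.append_nil]
    at h1' h2 h3 h4
  rw [Data.conj, Data.conj, Data.conj, ← h2, ← h1', h3.2, h4]

/-- A conjugate of a subgroup inside a subgroup `S` is a subgroup, provided the words
`(g⁻¹, x, g, g⁻¹, y, g)` lie in the domain. -/
theorem IsPartialGroup.conjSet_isSubgroup (hP : IsPartialGroup P) {R S : Set L} {g : L}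
    (hR : P.IsSubgroup R) (hS : P.IsSubgroup S) (hRg : R ⊆ P.Dconj g)
    (hRS : P.conjSet R g ⊆ S)
    (hw : ∀ x ∈ R, ∀ y ∈ R, [P.inv g, x, g, P.inv g, y, g] ∈ P.D) :
    P.IsSubgroup (P.conjSet R g) := by
  have hD : Wrd (P.conjSet R g) ⊆ P.D := fun w hw' => hS.word_mem fun x hx => hRS (hw' x hx)
  refine ⟨⟨?_, ?_⟩, hD⟩
  · rintro _ ⟨x, hx, rfl⟩
    exact ⟨P.inv x, hR.1.1 x hx, hP.conj_inv (hRg hx)⟩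
  · rintro w ⟨hwR, -⟩
    induction w with
    | nil => exact ⟨P.one, hR.one_mem, hP.one_conj g⟩
    | cons a w ih =>
      have haw := hD hwR
      obtain ⟨x, hx, rfl⟩ := hwR a (by simp)
      obtain ⟨y, hy, hyw⟩ := ih fun z hz => hwR z (by simp [hz])
      have h1 := hP.assoc_pi [P.conj x g] w [] (by simpa using haw)
      simp only [List.singleton_append, List.append_nil] at h1
      refine ⟨P.pi [x, y], hR.pi_mem (by simp [hx, hy]), ?_⟩
      simp only at hyw ⊢
      rw [h1, ← hyw, hP.conj_mul (hw x hx y hy)]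

/-- A subgroup of a partial group is a group under the binary product. -/
@[reducible]
def groupOfIsSubgroup (hP : IsPartialGroup P) {H : Set L} (hH : P.IsSubgroup H) : Group H :=
  letI : Mul H := ⟨fun x y => ⟨P.pi [x.1, y.1], hH.pi_mem (by simp)⟩⟩
  letI : One H := ⟨⟨P.one, hH.one_mem⟩⟩
  letI : Inv H := ⟨fun x => ⟨P.inv x.1, hH.1.1 _ x.2⟩⟩
  Group.ofLeftAxioms
    (fun x y z => by
      have hw : [x.1, y.1, z.1] ∈ P.D := hH.word_mem (by simp)
      have h1 := hP.assoc_pi [] [x.1, y.1] [z.1] hw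
      have h2 := hP.assoc_pi [x.1] [y.1, z.1] [] hw
      exact Subtype.ext (h1.symm.trans h2))
    (fun x => by
      have h1 := hP.assoc_pi [] [] [x.1] (hP.singleton_mem x.1)
      exact Subtype.ext (h1.symm.trans (hP.pi_singleton x.1)))
    (fun x => Subtype.ext (hP.pi_inv_self x.1))

theorem IsHom.map_inv {β : L → L'} (hβ : IsHom P P' β) (hP : IsPartialGroup P)
    (hP' : IsPartialGroup P') (f : L) : β (P.inv f) = P'.inv (β f) := by
  have h : [P.inv f, f] ∈ P.D := by
    simpa [Data.wInv] using hP.wInv_mem [f] (hP.singleton_mem f)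
  have hnil : ([] : List L) ∈ P.D := hP.append_left [] [f] (hP.singleton_mem f)
  refine hP'.eq_inv_of_pi_eq_one (by simpa using hβ.1 _ h) ?_
  have h1 := hβ.2 _ h
  rw [hP.pi_inv_self, Data.one, ← hβ.2 _ hnil] at h1
  simpa [Data.one] using h1

theorem IsHom.image_isSubgroup {β : L → L'} (hβ : IsHom P P' β) (hP : IsPartialGroup P)
    (hP' : IsPartialGroup P') {H : Set L} (hH : P.IsSubgroup H) : P'.IsSubgroup (β '' H) := by
  have lift : ∀ w ∈ Wrd (β '' H), ∃ v ∈ Wrd H, v.map β = w := by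
    intro w hw
    obtain ⟨v, hv, hvw⟩ : ∃ v : List L, (∀ x ∈ v, x ∈ H) ∧ v.map β = w := by
      induction w with
      | nil => exact ⟨[], by simp, rfl⟩
      | cons a w ih =>
        obtain ⟨x, hx, rfl⟩ := hw a (by simp)
        obtain ⟨v, hv, rfl⟩ := ih fun z hz => hw z (by simp [hz])
        exact ⟨x :: v, by simpa using ⟨hx, hv⟩, rfl⟩
    exact ⟨v, hv, hvw⟩
  refine ⟨⟨?_, ?_⟩, ?_⟩
  · rintro _ ⟨x, hx, rfl⟩
    exact ⟨P.inv x, hH.1.1 x hx, hβ.map_inv hP hP' x⟩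
  · rintro w ⟨hw, -⟩
    obtain ⟨v, hv, rfl⟩ := lift w hw
    exact ⟨P.pi v, hH.pi_mem hv, (hβ.2 v (hH.2 hv)).symm⟩
  · intro w hw
    obtain ⟨v, hv, rfl⟩ := lift w hw
    exact hβ.1 v (hH.2 hv)

/-- The image of a `p`-subgroup under a homomorphism is a `p`-subgroup. -/
theorem IsHom.image_isPSubgroup {p : ℕ} (hp : p.Prime) {β : L → L'} (hβ : IsHom P P' β)
    (hP : IsPartialGroup P) (hP' : IsPartialGroup P') {H : Set L} (hH : P.IsPSubgroup p H) :
    P'.IsPSubgroup p (β '' H) := by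
  obtain ⟨hH, n, hn⟩ := hH
  have hI := hβ.image_isSubgroup hP hP' hH
  let := groupOfIsSubgroup hP hH
  let := groupOfIsSubgroup hP' hI
  let φ : H →* (β '' H : Set L') := MonoidHom.mk'
    (fun x => ⟨β x.1, x.1, x.2, rfl⟩)
    (fun x y => Subtype.ext (hβ.2 [x.1, y.1] (hH.word_mem (by simp))).symm)
  have hφ : Function.Surjective φ := by
    rintro ⟨_, x, hx, rfl⟩
    exact ⟨⟨x, hx⟩, rfl⟩
  have hdvd := Subgroup.card_dvd_of_surjective φ hφ
  rw [Nat.card_coe_set_eq, Nat.card_coe_set_eq, hn] at hdvd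
  obtain ⟨k, -, hk⟩ := (Nat.dvd_prime_pow hp).1 hdvd
  exact ⟨hI, k, hk⟩

end PartialGroupBasics

section LocalityBasics

variable {p : ℕ} {P : Data L} {Δ : Set (Set L)} {S : Set L}

/-- `Q` and `Q'` are members of `Δ`, and `Q^f` is defined and equal to `Q'`. -/
def DeltaStep (P : Data L) (Δ : Set (Set L)) (Q : Set L) (f : L) (Q' : Set L) : Prop :=
  Q ∈ Δ ∧ Q' ∈ Δ ∧ Q ⊆ P.Dconj f ∧ P.conjSet Q f = Q'

theorem DeltaStep.chainFrom_cons {Q Q' : Set L} {f : L} {w : List L}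
    (h : DeltaStep P Δ Q f Q') (hw : chainFrom P Δ w Q') : chainFrom P Δ (f :: w) Q := by
  obtain ⟨-, h2, h3, rfl⟩ := h
  exact ⟨h3, h2, hw⟩

theorem DeltaStep.symm (hP : IsPartialGroup P) {Q Q' : Set L} {f : L}
    (h : DeltaStep P Δ Q f Q') : DeltaStep P Δ Q' (P.inv f) Q := by
  obtain ⟨h1, h2, h3, rfl⟩ := h
  exact ⟨h2, h1, hP.conjSet_inv h3⟩

theorem IsLocality.mem_D (h : IsLocality p P Δ S) {Q : Set L} (hQ : Q ∈ Δ) {w : List L}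
    (hw : chainFrom P Δ w Q) : w ∈ P.D := by
  rw [h.d_eq]
  exact ⟨Q, hQ, hw⟩

theorem IsLocality.deltaStep_of_mem (h : IsLocality p P Δ S) {X : Set L} (hX : X ∈ Δ) {a : L}
    (ha : a ∈ S) : DeltaStep P Δ X a (P.conjSet X a) := by
  have hS := h.pSubgroup.1
  obtain ⟨hXsub, hXS⟩ := h.delta_subgroups X hX
  have hXa : X ⊆ P.Dconj a := fun x hx => hS.conj_word_mem (hXS hx) ha
  have hXaS : P.conjSet X a ⊆ S := by
    rintro _ ⟨x, hx, rfl⟩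
    exact hS.conj_mem (hXS hx) ha
  refine ⟨hX, h.delta_closed _ ?_ hXaS ⟨X, hX, a, hXa, subset_rfl⟩, hXa, rfl⟩
  refine h.isPartialGroup.conjSet_isSubgroup hXsub hS hXa hXaS fun x hx y hy => ?_
  exact hS.word_mem (by simp [ha, hS.1.1 a ha, hXS hx, hXS hy])

/-- If `X^g = Y` in `Δ` and `a, a^g ∈ S`, then `(X^a)^g = Y^(a^g)` in `Δ`. -/
theorem IsLocality.deltaStep_conj (h : IsLocality p P Δ S) {X Y : Set L} {g a : L}
    (hXY : DeltaStep P Δ X g Y) (ha : a ∈ S) (hag : a ∈ P.Dconj g) (hb : P.conj a g ∈ S) :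
    DeltaStep P Δ (P.conjSet X a) g (P.conjSet Y (P.conj a g)) := by
  have hP := h.isPartialGroup
  have hXa := h.deltaStep_of_mem hXY.1 ha
  have hYb := h.deltaStep_of_mem hXY.2.1 hb
  set b := P.conj a g with hbdef
  have hmem : [P.inv a, g, b] ∈ P.D :=
    h.mem_D hXa.2.1 ((hXa.symm hP).chainFrom_cons
      (hXY.chainFrom_cons (hYb.chainFrom_cons trivial)))
  have hpi : P.pi [P.inv a, g, b] = g := by
    have hgag : [g, P.inv g, a, g] ∈ P.D :=
      hP.append_left _ [P.inv g] (by simpa using hP.conj_word_mem hag)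
    have h1 := hP.assoc_pi [P.inv a] [g, b] [] (by simpa using hmem)
    have h2 := hP.assoc_pi [g] [P.inv g, a, g] [] (by simpa using hgag)
    have h3 := hP.erase [] [g, P.inv g] [a, g] (by simpa using hgag) (hP.pi_self_inv g)
    have h4 : [P.inv a, a, g] ∈ P.D := by
      refine hP.append_right [P.inv g] _ ?_
      simpa [Data.wInv] using hP.wInv_mem [a, g] h3.1
    have h5 := hP.assoc_pi [P.inv a] [a, g] [] (by simpa using h4)
    have h6 := hP.erase [] [P.inv a, a] [g] (by simpa using h4) (hP.pi_inv_self a)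
    simp only [List.cons_append, List.nil_append, List.append_nil,
      hP.pi_singleton] at h1 h2 h3 h5 h6
    change P.pi [g, P.inv g, a, g] = P.pi [g, b] at h2
    rw [h1, ← h2, h3.2, ← h5, h6.2]
  have hpi' : P.pi [P.inv b, P.inv g, a] = P.inv g := by
    have := hP.pi_wInv hmem
    rw [hpi] at this
    simpa [Data.wInv, hP.inv_inv] using this
  have key : ∀ x ∈ P.conjSet X a,
      [P.inv b, P.inv g, a, x, P.inv a, g, b] ∈ P.D := by
    intro x hx
    have hsub := (h.delta_subgroups _ hXa.2.1).1
    have hxx : DeltaStep P Δ (P.conjSet X a) x (P.conjSet X a) :=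
      ⟨hXa.2.1, hXa.2.1, fun y hy => hsub.conj_word_mem hy hx, hP.conjSet_self hsub hx⟩
    exact h.mem_D hYb.2.1 ((hYb.symm hP).chainFrom_cons ((hXY.symm hP).chainFrom_cons
      (hXa.chainFrom_cons (hxx.chainFrom_cons ((hXa.symm hP).chainFrom_cons
      (hXY.chainFrom_cons (hYb.chainFrom_cons trivial)))))))
  have collapse : ∀ x ∈ P.conjSet X a, x ∈ P.Dconj g ∧
      P.pi [P.inv b, P.inv g, a, x, P.inv a, g, b] = P.conj x g := by
    intro x hx
    have h1 := hP.assoc_mem [] [P.inv b, P.inv g, a] [x, P.inv a, g, b] (key x hx)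
    have h1' := hP.assoc_pi [] [P.inv b, P.inv g, a] [x, P.inv a, g, b] (key x hx)
    rw [hpi'] at h1 h1'
    have h2 := hP.assoc_mem [P.inv g, x] [P.inv a, g, b] [] (by simpa using h1)
    have h2' := hP.assoc_pi [P.inv g, x] [P.inv a, g, b] [] (by simpa using h1)
    rw [hpi] at h2 h2'
    exact ⟨by simpa [Data.Dconj] using h2, h1'.trans h2'⟩
  refine ⟨hXa.2.1, hYb.2.1, fun x hx => (collapse x hx).1, ?_⟩
  rw [← hXY.2.2.2]
  simp only [Data.conjSet, Set.image_image]
  refine Set.image_congr fun x hx => ?_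
  have hx' : P.conj x a ∈ P.conjSet X a := ⟨x, hx, rfl⟩
  have h0 := key _ hx'
  have h1 := hP.assoc_mem [P.inv b, P.inv g] [a, P.conj x a, P.inv a] [g, b] h0
  have h1' := hP.assoc_pi [P.inv b, P.inv g] [a, P.conj x a, P.inv a] [g, b] h0
  have hx2 : P.pi [a, P.conj x a, P.inv a] = x := by
    have := hP.conj_conj_inv (hXa.2.2.1 hx)
    rwa [Data.conj, hP.inv_inv] at this
  rw [hx2] at h1 h1'
  have h2' := hP.assoc_pi [P.inv b] [P.inv g, x, g] [b] h1
  rw [← (collapse _ hx').2]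
  exact h1'.trans h2'

/-- A conjugate of a member of `Δ` that lies in `S` is a member of `Δ`. -/
theorem IsLocality.conjSet_mem_delta (h : IsLocality p P Δ S) {R : Set L} {g : L} (hR : R ∈ Δ)
    (hRg : R ⊆ P.Dconj g) (hRS : P.conjSet R g ⊆ S) : P.conjSet R g ∈ Δ := by
  have hP := h.isPartialGroup
  obtain ⟨hRsub, hRS'⟩ := h.delta_subgroups R hR
  refine h.delta_closed _ ?_ hRS ⟨R, hR, g, hRg, subset_rfl⟩
  refine hP.conjSet_isSubgroup hRsub h.pSubgroup.1 hRg hRS fun x hx y hy => ?_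
  have hg := hP.singleton_mem g
  rw [h.d_eq] at hg
  obtain ⟨X, hX, hXg, hY, -⟩ := hg
  have s0 : DeltaStep P Δ X g (P.conjSet X g) := ⟨hX, hY, hXg, rfl⟩
  have s1 := h.deltaStep_conj s0 (hRS' hx) (hRg hx) (hRS ⟨x, hx, rfl⟩)
  have s2 := h.deltaStep_conj s1 (hRS' hy) (hRg hy) (hRS ⟨y, hy, rfl⟩)
  exact h.mem_D hY ((s0.symm hP).chainFrom_cons
    ((h.deltaStep_of_mem hX (hRS' hx)).chainFrom_cons (s1.chainFrom_cons
    ((s1.symm hP).chainFrom_cons ((h.deltaStep_of_mem s1.1 (hRS' hy)).chainFrom_cons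
    (s2.chainFrom_cons trivial))))))

end LocalityBasics

section Product

variable {p : ℕ} {P₁ : Data L₁} {P₂ : Data L₂} {Δ₁ : Set (Set L₁)} {Δ₂ : Set (Set L₂)}
  {S₁ : Set L₁} {S₂ : Set L₂}

theorem prodData_isPartialGroup (h₁ : IsPartialGroup P₁) (h₂ : IsPartialGroup P₂) :
    IsPartialGroup (prodData P₁ P₂) where
  inv_inv f := Prod.ext (h₁.inv_inv f.1) (h₂.inv_inv f.2)
  singleton_mem f := ⟨h₁.singleton_mem f.1, h₂.singleton_mem f.2⟩
  append_left u v h := by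
    simp only [prodData, Set.mem_ofPred_eq, List.map_append] at h ⊢
    exact ⟨h₁.append_left _ _ h.1, h₂.append_left _ _ h.2⟩
  append_right u v h := by
    simp only [prodData, Set.mem_ofPred_eq, List.map_append] at h ⊢
    exact ⟨h₁.append_right _ _ h.1, h₂.append_right _ _ h.2⟩
  pi_singleton f := Prod.ext (h₁.pi_singleton f.1) (h₂.pi_singleton f.2)
  assoc_mem u v w h := by
    simp only [prodData, Set.mem_ofPred_eq, List.map_append] at h ⊢
    exact ⟨h₁.assoc_mem _ _ _ h.1, h₂.assoc_mem _ _ _ h.2⟩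
  assoc_pi u v w h := by
    simp only [prodData, Set.mem_ofPred_eq, List.map_append] at h ⊢
    exact Prod.ext (h₁.assoc_pi _ _ _ h.1) (h₂.assoc_pi _ _ _ h.2)
  wInv_mem w h := by
    have a := h₁.wInv_mem _ h.1
    have b := h₂.wInv_mem _ h.2
    simp only [Data.wInv, List.map_map] at a b
    simpa [prodData, Data.wInv, Function.comp_def] using And.intro a b
  wInv_pi w h := by
    have a := h₁.wInv_pi _ h.1
    have b := h₂.wInv_pi _ h.2
    simp only [Data.wInv, List.map_map, Data.one] at a b
    simpa [prodData, Data.wInv, Function.comp_def, Data.one] using And.intro a b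

theorem isHom_fst : IsHom (prodData P₁ P₂) P₁ Prod.fst :=
  ⟨fun _ hw => hw.1, fun _ _ => rfl⟩

theorem isHom_snd : IsHom (prodData P₁ P₂) P₂ Prod.snd :=
  ⟨fun _ hw => hw.2, fun _ _ => rfl⟩

theorem prod_isSubgroup {H₁ : Set L₁} {H₂ : Set L₂} (h₁ : P₁.IsSubgroup H₁)
    (h₂ : P₂.IsSubgroup H₂) : (prodData P₁ P₂).IsSubgroup (H₁ ×ˢ H₂) := by
  have fstMem : ∀ w ∈ Wrd (H₁ ×ˢ H₂), w.map Prod.fst ∈ Wrd H₁ := by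
    intro w hw x hx
    obtain ⟨y, hy, rfl⟩ := List.mem_map.1 hx
    exact (hw y hy).1
  have sndMem : ∀ w ∈ Wrd (H₁ ×ˢ H₂), w.map Prod.snd ∈ Wrd H₂ := by
    intro w hw x hx
    obtain ⟨y, hy, rfl⟩ := List.mem_map.1 hx
    exact (hw y hy).2
  exact ⟨⟨fun f hf => ⟨h₁.1.1 _ hf.1, h₂.1.1 _ hf.2⟩,
    fun w hw => ⟨h₁.pi_mem (fstMem w hw.1), h₂.pi_mem (sndMem w hw.1)⟩⟩,
    fun w hw => ⟨h₁.2 (fstMem w hw), h₂.2 (sndMem w hw)⟩⟩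

theorem conjSet_prod (R₁ : Set L₁) (R₂ : Set L₂) (g : L₁ × L₂) :
    (prodData P₁ P₂).conjSet (R₁ ×ˢ R₂) g = P₁.conjSet R₁ g.1 ×ˢ P₂.conjSet R₂ g.2 :=
  (Set.prod_image_image_eq (m₁ := fun x => P₁.conj x g.1) (m₂ := fun x => P₂.conj x g.2)).symm

theorem prod_mem_deltaStar (h₁ : IsLocality p P₁ Δ₁ S₁) (h₂ : IsLocality p P₂ Δ₂ S₂)
    {R₁ : Set L₁} {R₂ : Set L₂} (hR₁ : R₁ ∈ Δ₁) (hR₂ : R₂ ∈ Δ₂) :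
    R₁ ×ˢ R₂ ∈ deltaStar P₁ P₂ Δ₁ Δ₂ S₁ S₂ :=
  ⟨prod_isSubgroup (h₁.delta_subgroups _ hR₁).1 (h₂.delta_subgroups _ hR₂).1,
    Set.prod_mono (h₁.delta_subgroups _ hR₁).2 (h₂.delta_subgroups _ hR₂).2,
    R₁, hR₁, R₂, hR₂, subset_rfl⟩

theorem chainFrom_prod (h₁ : IsLocality p P₁ Δ₁ S₁) (h₂ : IsLocality p P₂ Δ₂ S₂)
    (w : List (L₁ × L₂)) {R₁ : Set L₁} {R₂ : Set L₂}
    (hR₁ : chainFrom P₁ Δ₁ (w.map Prod.fst) R₁) (hR₂ : chainFrom P₂ Δ₂ (w.map Prod.snd) R₂) :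
    chainFrom (prodData P₁ P₂) (deltaStar P₁ P₂ Δ₁ Δ₂ S₁ S₂) w (R₁ ×ˢ R₂) := by
  induction w generalizing R₁ R₂ with
  | nil => trivial
  | cons f w ih =>
    obtain ⟨a₁, b₁, c₁⟩ := hR₁
    obtain ⟨a₂, b₂, c₂⟩ := hR₂
    refine ⟨fun x hx => ⟨a₁ hx.1, a₂ hx.2⟩, ?_, ?_⟩ <;> rw [conjSet_prod]
    · exact prod_mem_deltaStar h₁ h₂ b₁ b₂
    · exact ih c₁ c₂

theorem conjSet_mem_delta_of_prod (h₁ : IsLocality p P₁ Δ₁ S₁) (h₂ : IsLocality p P₂ Δ₂ S₂)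
    {R₁ : Set L₁} {R₂ : Set L₂} {Q : Set (L₁ × L₂)} {g : L₁ × L₂} (hR₁ : R₁ ∈ Δ₁)
    (hR₂ : R₂ ∈ Δ₂) (hRQ : R₁ ×ˢ R₂ ⊆ Q) (hQg : Q ⊆ (prodData P₁ P₂).Dconj g)
    (hQS : (prodData P₁ P₂).conjSet Q g ⊆ S₁ ×ˢ S₂) :
    (R₁ ⊆ P₁.Dconj g.1 ∧ P₁.conjSet R₁ g.1 ∈ Δ₁) ∧
      (R₂ ⊆ P₂.Dconj g.2 ∧ P₂.conjSet R₂ g.2 ∈ Δ₂) ∧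
      P₁.conjSet R₁ g.1 ×ˢ P₂.conjSet R₂ g.2 ⊆ (prodData P₁ P₂).conjSet Q g := by
  have one₁ := (h₁.delta_subgroups _ hR₁).1.one_mem
  have one₂ := (h₂.delta_subgroups _ hR₂).1.one_mem
  have d₁ : R₁ ⊆ P₁.Dconj g.1 := fun x hx => (hQg (hRQ (Set.mk_mem_prod hx one₂))).1
  have d₂ : R₂ ⊆ P₂.Dconj g.2 := fun x hx => (hQg (hRQ (Set.mk_mem_prod one₁ hx))).2
  refine ⟨⟨d₁, h₁.conjSet_mem_delta hR₁ d₁ ?_⟩, ⟨d₂, h₂.conjSet_mem_delta hR₂ d₂ ?_⟩, ?_⟩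
  · rintro _ ⟨x, hx, rfl⟩
    exact (hQS ⟨_, hRQ (Set.mk_mem_prod hx one₂), rfl⟩).1
  · rintro _ ⟨x, hx, rfl⟩
    exact (hQS ⟨_, hRQ (Set.mk_mem_prod one₁ hx), rfl⟩).2
  · rw [← conjSet_prod]
    exact Set.image_mono hRQ

theorem chainFrom_of_prod (h₁ : IsLocality p P₁ Δ₁ S₁) (h₂ : IsLocality p P₂ Δ₂ S₂)
    (w : List (L₁ × L₂)) {R₁ : Set L₁} {R₂ : Set L₂} {Q : Set (L₁ × L₂)} (hR₁ : R₁ ∈ Δ₁)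
    (hR₂ : R₂ ∈ Δ₂) (hRQ : R₁ ×ˢ R₂ ⊆ Q)
    (hQ : chainFrom (prodData P₁ P₂) (deltaStar P₁ P₂ Δ₁ Δ₂ S₁ S₂) w Q) :
    chainFrom P₁ Δ₁ (w.map Prod.fst) R₁ ∧ chainFrom P₂ Δ₂ (w.map Prod.snd) R₂ := by
  induction w generalizing R₁ R₂ Q with
  | nil => exact ⟨trivial, trivial⟩
  | cons f w ih =>
    obtain ⟨a, b, c⟩ := hQ
    obtain ⟨⟨d₁, e₁⟩, ⟨d₂, e₂⟩, hsub⟩ := conjSet_mem_delta_of_prod h₁ h₂ hR₁ hR₂ hRQ a b.2.1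
    obtain ⟨c₁, c₂⟩ := ih e₁ e₂ hsub c
    exact ⟨⟨d₁, e₁, c₁⟩, ⟨d₂, e₂, c₂⟩⟩

end Product

/-- Lemma 5.1 (first part): the external direct product
`(L₁ × L₂, Δ₁*Δ₂, S₁ × S₂)` of two localities `(L_i,Δ_i,S_i)` is a locality. -/
theorem prod_isLocality (p : ℕ) (hp : p.Prime)
    (P₁ : Data L₁) (Δ₁ : Set (Set L₁)) (S₁ : Set L₁)
    (P₂ : Data L₂) (Δ₂ : Set (Set L₂)) (S₂ : Set L₂)
    (h₁ : IsLocality p P₁ Δ₁ S₁) (h₂ : IsLocality p P₂ Δ₂ S₂) :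
    IsLocality p (prodData P₁ P₂) (deltaStar P₁ P₂ Δ₁ Δ₂ S₁ S₂) (S₁ ×ˢ S₂) := by
  have hP₁ := h₁.isPartialGroup
  have hP₂ := h₂.isPartialGroup
  have hP := prodData_isPartialGroup hP₁ hP₂
  have := h₁.finite
  have := h₂.finite
  refine ⟨hP, inferInstance, ?_, ?_, fun Q hQ => ⟨hQ.1, hQ.2.1⟩, ?_, ?_, ?_⟩
  · obtain ⟨s₁, n₁, c₁⟩ := h₁.pSubgroup
    obtain ⟨s₂, n₂, c₂⟩ := h₂.pSubgroup
    exact ⟨prod_isSubgroup s₁ s₂, n₁ + n₂, by rw [Set.ncard_prod, c₁, c₂, pow_add]⟩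
  · obtain ⟨R₁, hR₁⟩ := h₁.delta_nonempty
    obtain ⟨R₂, hR₂⟩ := h₂.delta_nonempty
    exact ⟨_, prod_mem_deltaStar h₁ h₂ hR₁ hR₂⟩
  · intro T hT hST
    have e₁ := h₁.s_maximal _ (isHom_fst.image_isPSubgroup hp hP hP₁ hT) fun x hx =>
      ⟨(x, P₂.one), hST ⟨hx, h₂.pSubgroup.1.one_mem⟩, rfl⟩
    have e₂ := h₂.s_maximal _ (isHom_snd.image_isPSubgroup hp hP hP₂ hT) fun x hx =>
      ⟨(P₁.one, x), hST ⟨h₁.pSubgroup.1.one_mem, hx⟩, rfl⟩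
    refine Set.Subset.antisymm (fun t ht => ⟨?_, ?_⟩) hST
    · exact e₁ ▸ Set.mem_image_of_mem Prod.fst ht
    · exact e₂ ▸ Set.mem_image_of_mem Prod.snd ht
  · ext w
    constructor
    · rintro ⟨hw₁, hw₂⟩
      rw [h₁.d_eq] at hw₁
      rw [h₂.d_eq] at hw₂
      obtain ⟨R₁, hR₁, c₁⟩ := hw₁
      obtain ⟨R₂, hR₂, c₂⟩ := hw₂
      exact ⟨_, prod_mem_deltaStar h₁ h₂ hR₁ hR₂, chainFrom_prod h₁ h₂ w c₁ c₂⟩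
    · rintro ⟨Q, ⟨-, -, R₁, hR₁, R₂, hR₂, hRQ⟩, hw⟩
      obtain ⟨c₁, c₂⟩ := chainFrom_of_prod h₁ h₂ w hR₁ hR₂ hRQ hw
      exact ⟨h₁.mem_D hR₁ c₁, h₂.mem_D hR₂ c₂⟩
  · rintro Q hQ hQS ⟨R, ⟨-, -, R₁, hR₁, R₂, hR₂, hRR⟩, g, hRg, hRQ⟩
    obtain ⟨⟨-, e₁⟩, ⟨-, e₂⟩, hsub⟩ :=
      conjSet_mem_delta_of_prod h₁ h₂ hR₁ hR₂ hRR hRg (hRQ.trans hQS)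
    exact ⟨hQ, hQS, _, e₁, _, e₂, hsub.trans hRQ⟩

end PartialGroups
end

section
/- Let p be a prime and let G_1 and G_2 be finite groups. Then the direct product G_1 × G_2 is of characteristic p if and only if both G_1 and G_2 are of characteristic p. -/
namespace PartialGroups

/-- `O_p(G)`: the largest normal `p`-subgroup of a group `G` (for finite `G`, the
supremum of the normal `p`-subgroups of `G` is the largest normal `p`-subgroup). -/
def pCore (p : ℕ) (G : Type*) [Group G] : Subgroup G :=
  sSup {H : Subgroup G | H.Normal ∧ IsPGroup p H}

/-- A finite group `G` is of characteristic `p` if `C_G(O_p(G)) ≤ O_p(G)`. -/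
def IsCharPGroup (p : ℕ) (G : Type*) [Group G] : Prop :=
  Subgroup.centralizer (pCore p G : Set G) ≤ pCore p G

theorem le_pCore {p : ℕ} {G : Type*} [Group G] {H : Subgroup G} (hn : H.Normal)
    (hH : IsPGroup p H) : H ≤ pCore p G :=
  le_sSup ⟨hn, hH⟩

theorem map_pCore_le_of_surjective (p : ℕ) {G K : Type*} [Group G] [Group K] (f : G →* K)
    (hf : Function.Surjective f) : (pCore p G).map f ≤ pCore p K :=
  Subgroup.map_le_iff_le_comap.2 <| sSup_le fun _ hH =>
    Subgroup.map_le_iff_le_comap.1 (le_pCore (hH.1.map f hf) (hH.2.map f))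

theorem map_inl_pCore_le (p : ℕ) (G₁ G₂ : Type*) [Group G₁] [Group G₂] :
    (pCore p G₁).map (MonoidHom.inl G₁ G₂) ≤ pCore p (G₁ × G₂) := by
  refine Subgroup.map_le_iff_le_comap.2 <| sSup_le fun H hH =>
    Subgroup.map_le_iff_le_comap.1 (le_pCore ?_ (hH.2.map _))
  refine ⟨?_⟩
  rintro _ ⟨x, hx, rfl⟩ ⟨a, b⟩
  exact ⟨a * x * a⁻¹, hH.1.conj_mem x hx a, by simp⟩

theorem map_inr_pCore_le (p : ℕ) (G₁ G₂ : Type*) [Group G₁] [Group G₂] :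
    (pCore p G₂).map (MonoidHom.inr G₁ G₂) ≤ pCore p (G₁ × G₂) := by
  refine Subgroup.map_le_iff_le_comap.2 <| sSup_le fun H hH =>
    Subgroup.map_le_iff_le_comap.1 (le_pCore ?_ (hH.2.map _))
  refine ⟨?_⟩
  rintro _ ⟨x, hx, rfl⟩ ⟨a, b⟩
  exact ⟨b * x * b⁻¹, hH.1.conj_mem x hx b, by simp⟩

theorem pCore_prod (p : ℕ) (G₁ G₂ : Type*) [Group G₁] [Group G₂] :
    pCore p (G₁ × G₂) = (pCore p G₁).prod (pCore p G₂) :=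
  le_antisymm
    (Subgroup.le_prod_iff.2
      ⟨map_pCore_le_of_surjective p (MonoidHom.fst G₁ G₂) Prod.fst_surjective,
        map_pCore_le_of_surjective p (MonoidHom.snd G₁ G₂) Prod.snd_surjective⟩)
    (Subgroup.prod_le_iff.2 ⟨map_inl_pCore_le p G₁ G₂, map_inr_pCore_le p G₁ G₂⟩)

theorem centralizer_subgroup_prod {G₁ G₂ : Type*} [Group G₁] [Group G₂] (H : Subgroup G₁)
    (K : Subgroup G₂) :
    Subgroup.centralizer (H.prod K : Set (G₁ × G₂)) =
      (Subgroup.centralizer (H : Set G₁)).prod (Subgroup.centralizer (K : Set G₂)) := by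
  ext ⟨a, b⟩
  simp only [Subgroup.mem_centralizer_iff, Subgroup.mem_prod, SetLike.mem_coe, Prod.forall,
    Prod.mk_mul_mk, Prod.mk.injEq]
  exact ⟨fun h => ⟨fun x hx => (h x 1 ⟨hx, K.one_mem⟩).1, fun y hy => (h 1 y ⟨H.one_mem, hy⟩).2⟩,
    fun h x y hxy => ⟨h.1 x hxy.1, h.2 y hxy.2⟩⟩

/-- Lemma 5.4: for a prime `p` and finite groups `G₁` and `G₂`, the direct product
`G₁ × G₂` is of characteristic `p` if and only if both `G₁` and `G₂` are of
characteristic `p`. -/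
theorem prod_isCharPGroup (p : ℕ) (hp : p.Prime) (G₁ G₂ : Type*) [Group G₁] [Group G₂]
    [Finite G₁] [Finite G₂] :
    IsCharPGroup p (G₁ × G₂) ↔ IsCharPGroup p G₁ ∧ IsCharPGroup p G₂ := by
  rw [IsCharPGroup, pCore_prod, centralizer_subgroup_prod]
  refine ⟨fun h => ⟨fun x hx => ?_, fun y hy => ?_⟩, fun h => Subgroup.prod_mono h.1 h.2⟩
  · exact (Subgroup.mem_prod.1 (@h (x, 1) (Subgroup.mem_prod.2 ⟨hx, Subgroup.one_mem _⟩))).1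
  · exact (Subgroup.mem_prod.1 (@h (1, y) (Subgroup.mem_prod.2 ⟨Subgroup.one_mem _, hy⟩))).2

end PartialGroups
end

section
/- Let L be a partial group with product Π : D → L which is the internal central product of partial subgroups L_1 and L_2. Then L_1 ⊆ C_L(L_2) and L_2 ⊆ C_L(L_1); in particular, for all f ∈ L_1 and g ∈ L_2, one has (f,g) ∈ D, (g,f) ∈ D and Π(f,g) = Π(g,f). Moreover, L is the internal central product of L_2 and L_1. -/
/-!
Background definitions for partial groups and localities in the sense of Chermak.

A *partial group* is given by `Data`: a domain `D` of words, a (total, but only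
meaningful on `D`) product `pi : List L → L`, and an inversion map, subject to the
axioms collected in `IsPartialGroup`.
-/

namespace PartialGroups

variable {L L' L₁ L₂ L₁' L₂' : Type*}

namespace IsPartialGroup

variable {P : Data L}

theorem insert_one_mem (hP : IsPartialGroup P) {u w : List L} (h : u ++ w ∈ P.D) :
    u ++ P.one :: w ∈ P.D := by
  simpa [Data.one] using hP.assoc_mem u [] w (by simpa using h)

theorem pi_insert_one (hP : IsPartialGroup P) {u w : List L} (h : u ++ w ∈ P.D) :
    P.pi (u ++ P.one :: w) = P.pi (u ++ w) := by
  simpa [Data.one] using (hP.assoc_pi u [] w (by simpa using h)).symm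

theorem mul_one_mem (hP : IsPartialGroup P) (f : L) : [f, P.one] ∈ P.D :=
  hP.insert_one_mem (u := [f]) (w := []) (hP.singleton_mem f)

theorem one_mul_mem (hP : IsPartialGroup P) (f : L) : [P.one, f] ∈ P.D :=
  hP.insert_one_mem (u := []) (w := [f]) (hP.singleton_mem f)

theorem pi_mul_one (hP : IsPartialGroup P) (f : L) : P.pi [f, P.one] = f :=
  (hP.pi_insert_one (u := [f]) (w := []) (hP.singleton_mem f)).trans (hP.pi_singleton f)

theorem pi_one_mul (hP : IsPartialGroup P) (f : L) : P.pi [P.one, f] = f :=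
  (hP.pi_insert_one (u := []) (w := [f]) (hP.singleton_mem f)).trans (hP.pi_singleton f)

theorem inv_mul_mem (hP : IsPartialGroup P) (f : L) : [P.inv f, f] ∈ P.D :=
  hP.wInv_mem [f] (hP.singleton_mem f)

theorem pi_inv_mul (hP : IsPartialGroup P) (f : L) : P.pi [P.inv f, f] = P.one :=
  hP.wInv_pi [f] (hP.singleton_mem f)

theorem inv_one_mul_mem (hP : IsPartialGroup P) (f : L) : [P.inv f, P.one, f] ∈ P.D :=
  hP.insert_one_mem (u := [P.inv f]) (w := [f]) (hP.inv_mul_mem f)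

theorem pi_inv_one_mul (hP : IsPartialGroup P) (f : L) :
    P.pi [P.inv f, P.one, f] = P.one :=
  (hP.pi_insert_one (u := [P.inv f]) (w := [f]) (hP.inv_mul_mem f)).trans (hP.pi_inv_mul f)

theorem one_mul_one_mem (hP : IsPartialGroup P) (f : L) : [P.one, f, P.one] ∈ P.D :=
  hP.insert_one_mem (u := []) (w := [f, P.one]) (hP.mul_one_mem f)

theorem pi_one_mul_one (hP : IsPartialGroup P) (f : L) : P.pi [P.one, f, P.one] = f :=
  (hP.pi_insert_one (u := []) (w := [f, P.one]) (hP.mul_one_mem f)).trans (hP.pi_mul_one f)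

theorem one_mem (hP : IsPartialGroup P) {M : Set L} (hM : P.IsPartialSubgroup M) :
    P.one ∈ M :=
  hM.2 [] ⟨by simp [Wrd], hP.append_left [] [P.one] (hP.singleton_mem _)⟩

end IsPartialGroup

theorem zipProd_comm {P : Data L} {u v : List L}
    (h : ∀ q ∈ u.zip v, P.pi [q.1, q.2] = P.pi [q.2, q.1]) :
    zipProd P u v = zipProd P v u := by
  unfold zipProd
  induction u generalizing v with
  | nil => simp
  | cons a u ih =>
    cases v with
    | nil => simp
    | cons b v =>
      simp only [List.zip_cons_cons, List.forall_mem_cons] at h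
      simp only [List.zipWith_cons_cons, h.1, ih h.2]

namespace IsInternalCentralProduct

variable {P : Data L} {M₁ M₂ : Set L}

theorem zipProd_mem (hC : IsInternalCentralProduct P M₁ M₂) {u v : List L}
    (hu : u ∈ P.D ∩ Wrd M₁) (hv : v ∈ P.D ∩ Wrd M₂) (hl : u.length = v.length)
    (hq : ∀ q ∈ u.zip v, [q.1, q.2] ∈ P.D) : zipProd P u v ∈ P.D := by
  rw [hC.1]
  exact ⟨u, v, hu, hv, hl, hq, rfl⟩

theorem mul_mem (hC : IsInternalCentralProduct P M₁ M₂) (hP : IsPartialGroup P)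
    (h₁ : P.IsPartialSubgroup M₁) (h₂ : P.IsPartialSubgroup M₂) {f g : L}
    (hf : f ∈ M₁) (hg : g ∈ M₂) : [f, g] ∈ P.D := by
  have h := hC.zipProd_mem (u := [f, P.one]) (v := [P.one, g])
    ⟨hP.mul_one_mem f, by simp [Wrd, hf, hP.one_mem h₁]⟩
    ⟨hP.one_mul_mem g, by simp [Wrd, hg, hP.one_mem h₂]⟩ rfl
    (by simp [hP.mul_one_mem, hP.one_mul_mem])
  simpa [zipProd, hP.pi_mul_one, hP.pi_one_mul] using h

theorem mul_comm_mem (hC : IsInternalCentralProduct P M₁ M₂) (hP : IsPartialGroup P)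
    (h₁ : P.IsPartialSubgroup M₁) (h₂ : P.IsPartialSubgroup M₂) {f g : L}
    (hf : f ∈ M₁) (hg : g ∈ M₂) : [g, f] ∈ P.D ∧ P.pi [f, g] = P.pi [g, f] := by
  have hu : [P.one, f] ∈ P.D ∩ Wrd M₁ :=
    ⟨hP.one_mul_mem f, by simp [Wrd, hf, hP.one_mem h₁]⟩
  have hv : [g, P.one] ∈ P.D ∩ Wrd M₂ :=
    ⟨hP.mul_one_mem g, by simp [Wrd, hg, hP.one_mem h₂]⟩
  have hq : ∀ q ∈ [P.one, f].zip [g, P.one], [q.1, q.2] ∈ P.D := by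
    simp [hP.mul_one_mem, hP.one_mul_mem]
  have hz : zipProd P [P.one, f] [g, P.one] = [g, f] := by
    simp [zipProd, hP.pi_mul_one, hP.pi_one_mul]
  have hm := hC.zipProd_mem hu hv rfl hq
  have hp := hC.2 _ _ hu hv rfl hq
  rw [hz] at hm hp
  rw [hP.pi_one_mul, hP.pi_mul_one] at hp
  exact ⟨hm, hp.symm⟩

theorem symm (hC : IsInternalCentralProduct P M₁ M₂) (hP : IsPartialGroup P)
    (h₁ : P.IsPartialSubgroup M₁) (h₂ : P.IsPartialSubgroup M₂) :
    IsInternalCentralProduct P M₂ M₁ := by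
  have hpair : ∀ {u v : List L}, u ∈ Wrd M₁ → v ∈ Wrd M₂ →
      (∀ q ∈ u.zip v, [q.1, q.2] ∈ P.D) ∧ (∀ q ∈ v.zip u, [q.1, q.2] ∈ P.D) ∧
        zipProd P u v = zipProd P v u := fun hu hv =>
    ⟨fun _ hq => hC.mul_mem hP h₁ h₂ (hu _ (List.of_mem_zip hq).1) (hv _ (List.of_mem_zip hq).2),
      fun _ hq =>
        (hC.mul_comm_mem hP h₁ h₂ (hu _ (List.of_mem_zip hq).2) (hv _ (List.of_mem_zip hq).1)).1,
      zipProd_comm fun _ hq =>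
        (hC.mul_comm_mem hP h₁ h₂ (hu _ (List.of_mem_zip hq).1) (hv _ (List.of_mem_zip hq).2)).2⟩
  refine ⟨?_, fun v u hv hu hl _ => ?_⟩
  · ext w
    constructor
    · intro hw
      rw [hC.1] at hw
      obtain ⟨u, v, hu, hv, hl, -, rfl⟩ := hw
      obtain ⟨-, hvu, hz⟩ := hpair hu.2 hv.2
      exact ⟨v, u, hv, hu, hl.symm, hvu, hz⟩
    · rintro ⟨v, u, hv, hu, hl, -, rfl⟩
      obtain ⟨huv, -, hz⟩ := hpair hu.2 hv.2
      exact hz ▸ hC.zipProd_mem hu hv hl.symm huv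
  · obtain ⟨huv, -, hz⟩ := hpair hu.2 hv.2
    rw [← hz, hC.2 u v hu hv hl.symm huv]
    exact (hC.mul_comm_mem hP h₁ h₂ (h₁.2 u hu.symm) (h₂.2 v hv.symm)).2

theorem left_subset_centralizer (hC : IsInternalCentralProduct P M₁ M₂)
    (hP : IsPartialGroup P) (h₁ : P.IsPartialSubgroup M₁) (h₂ : P.IsPartialSubgroup M₂) :
    M₁ ⊆ P.centralizer M₂ := by
  intro f hf x hx
  have hu : [P.inv f, P.one, f] ∈ P.D ∩ Wrd M₁ :=
    ⟨hP.inv_one_mul_mem f, by simp [Wrd, hf, hP.one_mem h₁, h₁.1 f hf]⟩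
  have hv : [P.one, x, P.one] ∈ P.D ∩ Wrd M₂ :=
    ⟨hP.one_mul_one_mem x, by simp [Wrd, hx, hP.one_mem h₂]⟩
  have hq : ∀ q ∈ [P.inv f, P.one, f].zip [P.one, x, P.one], [q.1, q.2] ∈ P.D := by
    simp [hP.mul_one_mem, hP.one_mul_mem]
  have hz : zipProd P [P.inv f, P.one, f] [P.one, x, P.one] = [P.inv f, x, f] := by
    simp [zipProd, hP.pi_mul_one, hP.pi_one_mul]
  have hm := hC.zipProd_mem hu hv rfl hq
  have hp := hC.2 _ _ hu hv rfl hq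
  rw [hz] at hm hp
  rw [hP.pi_inv_one_mul, hP.pi_one_mul_one, hP.pi_one_mul] at hp
  exact ⟨hm, hp⟩

end IsInternalCentralProduct

/-- Lemma 6.3: if the partial group `L` is the internal central product of the
partial subgroups `M₁` and `M₂`, then `M₁ ⊆ C_L(M₂)` and `M₂ ⊆ C_L(M₁)`; in
particular `(f,g),(g,f) ∈ D` and `fg = gf` for all `f ∈ M₁`, `g ∈ M₂`.  Moreover
`L` is the internal central product of `M₂` and `M₁`. -/
theorem internalCentralProduct_comm (P : Data L) (hP : IsPartialGroup P)
    (M₁ M₂ : Set L) (h₁ : P.IsPartialSubgroup M₁) (h₂ : P.IsPartialSubgroup M₂)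
    (hC : IsInternalCentralProduct P M₁ M₂) :
    M₁ ⊆ P.centralizer M₂ ∧ M₂ ⊆ P.centralizer M₁ ∧
    (∀ f ∈ M₁, ∀ g ∈ M₂, [f, g] ∈ P.D ∧ [g, f] ∈ P.D ∧ P.pi [f, g] = P.pi [g, f]) ∧
    IsInternalCentralProduct P M₂ M₁ := by
  have hC' := hC.symm hP h₁ h₂
  exact ⟨hC.left_subset_centralizer hP h₁ h₂, hC'.left_subset_centralizer hP h₂ h₁,
    fun _ hf _ hg => ⟨hC.mul_mem hP h₁ h₂ hf hg, hC.mul_comm_mem hP h₁ h₂ hf hg⟩, hC'⟩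

end PartialGroups
end
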